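/- Assume the local integrability condition ∫₀¹ sup_{|x| ≤ R}(|b(s,x)| + ‖σ(s,x)‖²) ds < ∞ for every R > 0, and the growth condition: there exist K > 0, a nonnegative g with ∫₀¹ g(t)² dt < ∞, and a differentiable γ : ℝ₊ → ℝ₊ with γ' ≥ 0, lim_{s→∞} γ(s) = ∞ and ∫_K^∞ ds/(γ(s)+1) = ∞, such that max(‖σ(t,x)‖² + 2⟨x, b(t,x)⟩, |σ(t,x)ᵀ x|) ≤ g(t)(γ(|x|²) + 1) for all |x| ≥ K and t ∈ [0,1]. Then for every α > 0 there exists M < ∞ such that for every absolutely continuous l with e(l) ≤ α and every solution h of the controlled equation driven by l, sup_{0 ≤ t ≤ 1} |h(t)| ≤ M. -/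

import Mathlib

open MeasureTheory Set Metric
open scoped RealInnerProductSpace ENNReal

noncomputable section

/-- Matrix times vector, landing in Euclidean space. -/
def mVec {d m : ℕ} (A : Matrix (Fin d) (Fin m) ℝ)
    (v : EuclideanSpace ℝ (Fin m)) : EuclideanSpace ℝ (Fin d) :=
  (WithLp.equiv 2 (Fin d → ℝ)).symm fun i => ∑ j, A i j * v j

/-- Transposed matrix times vector (`σᵀ x`), landing in Euclidean space. -/
def mVecT {d m : ℕ} (A : Matrix (Fin d) (Fin m) ℝ)
    (x : EuclideanSpace ℝ (Fin d)) : EuclideanSpace ℝ (Fin m) :=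
  (WithLp.equiv 2 (Fin m → ℝ)).symm fun j => ∑ i, A i j * x i

/-- Square of the Frobenius (Hilbert–Schmidt) norm `‖A‖² = ∑ᵢⱼ Aᵢⱼ²`. -/
def frobSq {d m : ℕ} (A : Matrix (Fin d) (Fin m) ℝ) : ℝ :=
  ∑ i, ∑ j, (A i j) ^ 2

/-- An admissible control: `l'` is (a.e. strongly) measurable on `[0,1]` and
`∫₀¹ ‖l'(t)‖² dt < ∞`; `l'` plays the role of the derivative of an absolutely
continuous path `l` with `l(0) = 0`, so that `e(l) = ∫₀¹ ‖l'(t)‖² dt`. -/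
def Adm {m : ℕ} (l' : ℝ → EuclideanSpace ℝ (Fin m)) : Prop :=
  AEStronglyMeasurable l' (volume.restrict (Icc 0 1)) ∧
    IntegrableOn (fun t => ‖l' t‖ ^ 2) (Icc 0 1)

/-- `h` is a solution on `[0,1]` of the controlled equation
`h(t) = x₀ + ∫₀ᵗ b(s, h(s)) ds + ∫₀ᵗ σ(s, h(s)) l'(s) ds` driven by the
absolutely continuous path `l` with derivative `l'`. -/
def IsSol {d m : ℕ} (b : ℝ → EuclideanSpace ℝ (Fin d) → EuclideanSpace ℝ (Fin d))
    (σ : ℝ → EuclideanSpace ℝ (Fin d) → Matrix (Fin d) (Fin m) ℝ)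
    (x₀ : EuclideanSpace ℝ (Fin d)) (l' : ℝ → EuclideanSpace ℝ (Fin m))
    (h : ℝ → EuclideanSpace ℝ (Fin d)) : Prop :=
  ContinuousOn h (Icc 0 1) ∧ ∀ t ∈ Icc (0:ℝ) 1,
    h t = x₀ + ∫ s in (0:ℝ)..t, (b s (h s) + mVec (σ s (h s)) (l' s))


open Filter

lemma AbsolutelyContinuousOnInterval.of_dist_le {X Y : Type*} [PseudoMetricSpace X]
    [PseudoMetricSpace Y] {f : ℝ → X} {G : ℝ → Y} {a b C : ℝ}
    (hG : AbsolutelyContinuousOnInterval G a b)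
    (hC : ∀ x ∈ uIcc a b, ∀ y ∈ uIcc a b, dist (f x) (f y) ≤ C * dist (G x) (G y)) :
    AbsolutelyContinuousOnInterval f a b := by
  rw [absolutelyContinuousOnInterval_iff] at hG ⊢
  intro ε hε
  obtain ⟨δ, hδ, h⟩ := hG (ε / (|C| + 1)) (by positivity)
  refine ⟨δ, hδ, fun E hE hEδ => ?_⟩
  have h1 := h E hE hEδ
  rw [lt_div_iff₀ (by positivity)] at h1
  refine lt_of_le_of_lt ?_ h1
  rw [Finset.sum_mul]
  refine Finset.sum_le_sum fun i hi => ?_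
  have hm := hE.1 i hi
  refine (hC _ hm.1 _ hm.2).trans ?_
  rw [mul_comm]
  gcongr
  linarith [le_abs_self C]

/-- Integrated chain rule, as an inequality, along an indefinite integral. -/
lemma sub_le_integral_of_fderiv_le {E : Type*} [NormedAddCommGroup E] [NormedSpace ℝ E]
    [FiniteDimensional ℝ E] {φ : E → ℝ} (hφ : ContDiff ℝ 1 φ) {F : ℝ → E} {k : ℝ → ℝ}
    {a b : ℝ} (hab : a ≤ b) (hF : IntervalIntegrable F volume a b) (c : E)
    (hk : IntervalIntegrable k volume a b)
    (hle : ∀ t ∈ Ioc a b, fderiv ℝ φ (c + ∫ s in a..t, F s) (F t) ≤ k t) :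
    φ (c + ∫ s in a..b, F s) - φ c ≤ ∫ s in a..b, k s := by
  set H : ℝ → E := fun t => c + ∫ s in a..t, F s with hH
  have hsub : ∀ x ∈ uIcc a b, ∀ y ∈ uIcc a b, IntervalIntegrable F volume x y :=
    fun x hx y hy => hF.mono_set (uIcc_subset_uIcc hx hy)
  have hdist : ∀ x ∈ uIcc a b, ∀ y ∈ uIcc a b,
      dist (H x) (H y) ≤ dist (∫ s in a..x, ‖F s‖) (∫ s in a..y, ‖F s‖) := by
    intro x hx y hy
    have ha : a ∈ uIcc a b := left_mem_uIcc
    rw [dist_eq_norm, dist_eq_norm, hH]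
    simp only [add_sub_add_left_eq_sub]
    rw [intervalIntegral.integral_interval_sub_left (hsub a ha x hx) (hsub a ha y hy),
      intervalIntegral.integral_interval_sub_left (hsub a ha x hx).norm (hsub a ha y hy).norm,
      Real.norm_eq_abs]
    exact intervalIntegral.norm_integral_le_abs_integral_norm
  have hac : AbsolutelyContinuousOnInterval H a b :=
    (hF.norm.absolutelyContinuousOnInterval_intervalIntegral left_mem_uIcc).of_dist_le
      (C := 1) (by simpa using hdist)
  obtain ⟨R, hR⟩ := hac.exists_bound
  obtain ⟨L, hL⟩ := hφ.contDiffOn.exists_lipschitzOnWith (s := closedBall (0 : E) R)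
    (by decide) (convex_closedBall _ _) (isCompact_closedBall _ _)
  have hacφ : AbsolutelyContinuousOnInterval (fun t => φ (H t)) a b :=
    hac.of_dist_le (C := L) fun x hx y hy =>
      hL.dist_le_mul _ (by simpa using hR x hx) _ (by simpa using hR y hy)
  have hHa : H a = c := by simp [hH]
  have hftc := hacφ.integral_deriv_eq_sub
  rw [hHa] at hftc
  rw [← hftc]
  refine intervalIntegral.integral_mono_ae_restrict hab hacφ.intervalIntegrable_deriv hk ?_
  rw [EventuallyLE, ← restrict_Ioc_eq_restrict_Icc, ae_restrict_iff' measurableSet_Ioc]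
  filter_upwards [hF.ae_hasDerivAt_integral] with t ht htm
  have htm' : t ∈ uIcc a b := by rw [uIcc_of_le hab]; exact Ioc_subset_Icc_self htm
  have h1 : HasDerivAt H (F t) t := (ht htm' a left_mem_uIcc).const_add c
  have h2 := ((hφ.differentiable (by decide)) (H t)).hasFDerivAt.comp_hasDerivAt t h1
  have h3 : deriv (fun t => φ (H t)) t = fderiv ℝ φ (H t) (F t) := h2.deriv
  rw [h3]
  exact hle t htm

lemma inner_mVec {d m : ℕ} (A : Matrix (Fin d) (Fin m) ℝ) (x : EuclideanSpace ℝ (Fin d))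
    (v : EuclideanSpace ℝ (Fin m)) : ⟪x, mVec A v⟫ = ⟪mVecT A x, v⟫ := by
  simp only [PiLp.inner_apply, mVec, mVecT, WithLp.equiv_symm_apply, RCLike.inner_apply,
    conj_trivial, Finset.sum_mul, Finset.mul_sum]
  rw [Finset.sum_comm]
  exact Finset.sum_congr rfl fun j _ => Finset.sum_congr rfl fun i _ => by ring

lemma frobSq_nonneg {d m : ℕ} (A : Matrix (Fin d) (Fin m) ℝ) : 0 ≤ frobSq A :=
  Finset.sum_nonneg fun _ _ => Finset.sum_nonneg fun _ _ => sq_nonneg _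

lemma norm_mVec_le {d m : ℕ} (A : Matrix (Fin d) (Fin m) ℝ) (v : EuclideanSpace ℝ (Fin m)) :
    ‖mVec A v‖ ≤ frobSq A + ‖v‖ ^ 2 := by
  have h : ‖mVec A v‖ ^ 2 ≤ frobSq A * ‖v‖ ^ 2 := by
    simp only [EuclideanSpace.norm_sq_eq, Real.norm_eq_abs, sq_abs, frobSq, Finset.sum_mul]
    refine Finset.sum_le_sum fun i _ => ?_
    simpa [mVec, Finset.sum_mul] using
      Finset.sum_mul_sq_le_sq_mul_sq Finset.univ (fun j => A i j) (fun j => v j)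
  have h0 := frobSq_nonneg A
  refine abs_le_of_sq_le_sq' ?_ (by positivity) |>.2
  nlinarith [mul_nonneg h0 (sq_nonneg ‖v‖), sq_nonneg (‖v‖ ^ 2), sq_nonneg (frobSq A)]

/-- The drift of the controlled equation along a continuous path is integrable. -/
lemma integrableOn_drift {d m : ℕ}
    {b : ℝ → EuclideanSpace ℝ (Fin d) → EuclideanSpace ℝ (Fin d)}
    {σ : ℝ → EuclideanSpace ℝ (Fin d) → Matrix (Fin d) (Fin m) ℝ}
    (hbmeas : Measurable (Function.uncurry b))
    (hσmeas : ∀ i j, Measurable fun p : ℝ × EuclideanSpace ℝ (Fin d) => σ p.1 p.2 i j)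
    (hloc : ∀ R > (0:ℝ), ∫⁻ s in Icc (0:ℝ) 1,
      ⨆ x ∈ Metric.closedBall (0 : EuclideanSpace ℝ (Fin d)) R,
        ENNReal.ofReal (‖b s x‖ + frobSq (σ s x)) < ⊤)
    {l' : ℝ → EuclideanSpace ℝ (Fin m)} (hl : Adm l')
    {h : ℝ → EuclideanSpace ℝ (Fin d)} (hh : ContinuousOn h (Icc 0 1)) :
    IntegrableOn (fun s => b s (h s) + mVec (σ s (h s)) (l' s)) (Icc 0 1) := by
  have hpair : AEMeasurable (fun s => (s, h s)) (volume.restrict (Icc (0:ℝ) 1)) :=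
    aemeasurable_id.prodMk (hh.aemeasurable measurableSet_Icc)
  have hb : AEMeasurable (fun s => b s (h s)) (volume.restrict (Icc (0:ℝ) 1)) :=
    hbmeas.comp_aemeasurable hpair
  have hσ : ∀ i j, AEMeasurable (fun s => σ s (h s) i j) (volume.restrict (Icc (0:ℝ) 1)) :=
    fun i j => (hσmeas i j).comp_aemeasurable hpair
  have hl' : ∀ j, AEMeasurable (fun s => l' s j) (volume.restrict (Icc (0:ℝ) 1)) := fun j =>
    (EuclideanSpace.proj (𝕜 := ℝ) j).continuous.measurable.comp_aemeasurable hl.1.aemeasurable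
  have hmV : AEMeasurable (fun s => mVec (σ s (h s)) (l' s)) (volume.restrict (Icc (0:ℝ) 1)) := by
    refine (WithLp.measurable_toLp 2 (Fin d → ℝ)).comp_aemeasurable (aemeasurable_pi_lambda _ ?_)
    exact fun i => Finset.aemeasurable_fun_sum _ fun j _ => (hσ i j).mul (hl' j)
  have hfrob : AEMeasurable (fun s => frobSq (σ s (h s))) (volume.restrict (Icc (0:ℝ) 1)) :=
    Finset.aemeasurable_fun_sum _ fun i _ => Finset.aemeasurable_fun_sum _ fun j _ =>
      (hσ i j).pow_const 2
  obtain ⟨R, hR⟩ := isCompact_Icc.exists_bound_of_continuousOn hh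
  have hint : IntegrableOn (fun s => ‖b s (h s)‖ + frobSq (σ s (h s))) (Icc 0 1) := by
    refine ⟨(hb.norm.add hfrob).aestronglyMeasurable, ?_⟩
    rw [hasFiniteIntegral_iff_ofReal
      (ae_of_all _ fun s => add_nonneg (norm_nonneg _) (frobSq_nonneg _))]
    refine lt_of_le_of_lt (setLIntegral_mono' measurableSet_Icc fun s hs => ?_)
      (hloc (max R 1) (by positivity))
    exact le_iSup₂ (f := fun x _ => ENNReal.ofReal (‖b s x‖ + frobSq (σ s x))) (h s)
      (by simpa using Or.inl (hR s hs))
  refine (hint.add hl.2).mono' (hb.add hmV).aestronglyMeasurable (ae_of_all _ fun s => ?_)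
  calc _ ≤ _ := norm_add_le _ _
    _ ≤ _ := add_le_add_right (norm_mVec_le _ _) _
    _ = _ := by simp [add_assoc]

/-- The increment of `Φ(|h|²)`, where `Φ` is a primitive of `ρ`, is controlled as long as the
path stays where the growth condition holds. -/
lemma increment_le {d : ℕ} {ρ : ℝ → ℝ} (hρ : Continuous ρ)
    {F : ℝ → EuclideanSpace ℝ (Fin d)} {k : ℝ → ℝ} {a t : ℝ} (hat : a ≤ t)
    (hF : IntervalIntegrable F volume a t) (c : EuclideanSpace ℝ (Fin d))
    (hk : IntervalIntegrable k volume a t)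
    (hle : ∀ s ∈ Ioc a t, ρ (‖c + ∫ r in a..s, F r‖ ^ 2) *
      (2 * ⟪c + ∫ r in a..s, F r, F s⟫) ≤ k s) :
    (∫ u in (0:ℝ)..‖c + ∫ r in a..t, F r‖ ^ 2, ρ u) - ∫ u in (0:ℝ)..‖c‖ ^ 2, ρ u
      ≤ ∫ s in a..t, k s := by
  have hder : ∀ v, HasDerivAt (fun v => ∫ u in (0:ℝ)..v, ρ u) (ρ v) v := fun v =>
    hρ.integral_hasStrictDerivAt 0 v |>.hasDerivAt
  have hΦ : ContDiff ℝ 1 (fun v => ∫ u in (0:ℝ)..v, ρ u) := by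
    rw [contDiff_one_iff_deriv]
    exact ⟨fun v => (hder v).differentiableAt, by
      rw [funext fun v => (hder v).deriv]; exact hρ⟩
  refine sub_le_integral_of_fderiv_le (φ := fun x => ∫ u in (0:ℝ)..‖x‖ ^ 2, ρ u)
    (hΦ.comp (contDiff_norm_sq ℝ)) hat hF c hk fun s hs => ?_
  refine le_of_eq_of_le ?_ (hle s hs)
  set x := c + ∫ r in a..s, F r
  have h1 := (hder (‖x‖ ^ 2)).comp_hasFDerivAt x (hasStrictFDerivAt_norm_sq x).hasFDerivAt
  have h2 := h1.fderiv
  simp only [Function.comp_def] at h2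
  rw [h2]
  simp

/-- under the local integrability condition and the growth
condition for `|x| ≥ K`, the controlled trajectories with energy `e(l) ≤ α`
are uniformly bounded on `[0,1]`. -/
theorem controlled_trajectories_bounded {d m : ℕ} (hd : 1 ≤ d) (hm : 1 ≤ m)
    (x₀ : EuclideanSpace ℝ (Fin d))
    (b : ℝ → EuclideanSpace ℝ (Fin d) → EuclideanSpace ℝ (Fin d))
    (σ : ℝ → EuclideanSpace ℝ (Fin d) → Matrix (Fin d) (Fin m) ℝ)
    (hbmeas : Measurable (Function.uncurry b))
    (hσmeas : ∀ i j, Measurable fun p : ℝ × EuclideanSpace ℝ (Fin d) => σ p.1 p.2 i j)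
    -- local integrability: ∫₀¹ sup_{|x| ≤ R} (|b(s,x)| + ‖σ(s,x)‖²) ds < ∞ for all R > 0
    (hloc : ∀ R > (0:ℝ), ∫⁻ s in Icc (0:ℝ) 1,
      ⨆ x ∈ Metric.closedBall (0 : EuclideanSpace ℝ (Fin d)) R,
        ENNReal.ofReal (‖b s x‖ + frobSq (σ s x)) < ⊤)
    -- growth condition for |x| ≥ K
    (K : ℝ) (hK : 0 < K) (g γ : ℝ → ℝ)
    (hg_nonneg : ∀ t, 0 ≤ g t)
    (hg_int : IntegrableOn (fun t => g t ^ 2) (Icc 0 1))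
    (hγ_diff : DifferentiableOn ℝ γ (Ici 0))
    (hγ_nonneg : ∀ u ∈ Ici (0:ℝ), 0 ≤ γ u)
    (hγ_deriv : ∀ u ∈ Ici (0:ℝ), 0 ≤ derivWithin γ (Ici 0) u)
    (hγ_top : Filter.Tendsto γ Filter.atTop Filter.atTop)
    (hγ_int : ∫⁻ s in Ioi K, ENNReal.ofReal (1 / (γ s + 1)) = ⊤)
    (hgrowth : ∀ t ∈ Icc (0:ℝ) 1, ∀ x : EuclideanSpace ℝ (Fin d), K ≤ ‖x‖ →
      max (frobSq (σ t x) + 2 * ⟪x, b t x⟫) ‖mVecT (σ t x) x‖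
        ≤ g t * (γ (‖x‖ ^ 2) + 1))
    :
    ∀ α > (0:ℝ), ∃ M : ℝ, ∀ l' : ℝ → EuclideanSpace ℝ (Fin m), Adm l' →
      (∫ t in Icc (0:ℝ) 1, ‖l' t‖ ^ 2) ≤ α →
      ∀ h : ℝ → EuclideanSpace ℝ (Fin d), IsSol b σ x₀ l' h →
        ∀ t ∈ Icc (0:ℝ) 1, ‖h t‖ ≤ M := by
  intro α _
  set ρ : ℝ → ℝ := fun s => 1 / (γ (max s 0) + 1) with hρdef
  have hpos : ∀ s, 0 < γ (max s 0) + 1 := fun s => by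
    linarith [hγ_nonneg (max s 0) (le_max_right s 0)]
  have hρpos : ∀ s, 0 < ρ s := fun s => one_div_pos.2 (hpos s)
  have hρ : Continuous ρ := by
    refine continuous_const.div (Continuous.add ?_ continuous_const) fun s => (hpos s).ne'
    exact hγ_diff.continuousOn.comp_continuous (continuous_id.max continuous_const)
      fun s => le_max_right s 0
  have hρi : ∀ x y, IntervalIntegrable ρ volume x y := fun x y => hρ.intervalIntegrable x y
  have hmono : Monotone fun v => ∫ u in (0:ℝ)..v, ρ u := by
    intro x y hxy
    have h1 := intervalIntegral.integral_interval_sub_left (hρi 0 y) (hρi 0 x)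
    have h2 := intervalIntegral.integral_nonneg (μ := volume) hxy fun u _ => (hρpos u).le
    simp only
    linarith
  have hunb : ∀ B : ℝ, ∃ V : ℝ, B < ∫ u in (0:ℝ)..V, ρ u := by
    intro B
    by_contra! hB
    have hI : IntegrableOn ρ (Ioi K) := by
      refine integrableOn_Ioi_of_intervalIntegral_norm_bounded
        (B - ∫ u in (0:ℝ)..K, ρ u) K (l := atTop) (b := id)
        (fun i => hρ.integrableOn_Ioc) tendsto_id (Eventually.of_forall fun i => ?_)
      simp only [Real.norm_of_nonneg (hρpos _).le, id]
      rw [← intervalIntegral.integral_interval_sub_left (hρi 0 i) (hρi 0 K)]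
      linarith [hB i]
    have h1 := hI.2
    rw [hasFiniteIntegral_iff_ofReal (ae_of_all _ fun s => (hρpos s).le)] at h1
    refine h1.ne ?_
    rw [← hγ_int]
    refine setLIntegral_congr_fun measurableSet_Ioi fun s hs => ?_
    simp only [hρdef, max_eq_left (hK.trans hs).le]
  set R := max K ‖x₀‖ with hR
  obtain ⟨V, hV⟩ := hunb ((∫ u in (0:ℝ)..R ^ 2, ρ u) +
    (2 * (∫ t in Icc (0:ℝ) 1, g t ^ 2) + 1 + α))
  refine ⟨max R (1 + |V|), fun l' hl hlα h hsol t ht => ?_⟩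
  by_contra! hlt
  obtain ⟨hRt, hVt⟩ := max_lt_iff.1 hlt
  set F := fun s => b s (h s) + mVec (σ s (h s)) (l' s) with hF
  have hFint : IntegrableOn F (Icc 0 1) := integrableOn_drift hbmeas hσmeas hloc hl hsol.1
  have hFi : ∀ x ∈ Icc (0:ℝ) 1, ∀ y ∈ Icc (0:ℝ) 1, IntervalIntegrable F volume x y :=
    fun x hx y hy => (hFint.mono_set (by
      rw [← uIcc_of_le zero_le_one] at hx hy ⊢
      exact uIcc_subset_uIcc hx hy)).intervalIntegrable
  have h00 : (0:ℝ) ∈ Icc (0:ℝ) 1 := ⟨le_rfl, zero_le_one⟩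
  have hcont : ContinuousOn (fun s => ‖h s‖) (Icc 0 t) :=
    hsol.1.norm.mono (Icc_subset_Icc_right ht.2)
  have hcpt : IsCompact (Icc 0 t ∩ (fun s => ‖h s‖) ⁻¹' Iic R) :=
    isCompact_Icc.of_isClosed_subset (hcont.preimage_isClosed_of_isClosed isClosed_Icc isClosed_Iic)
      inter_subset_left
  have hh0 : h 0 = x₀ := by simpa using hsol.2 0 h00
  obtain ⟨a, ⟨⟨ha0, hat⟩, haR⟩, hamax⟩ := hcpt.exists_isGreatest
    ⟨0, ⟨le_rfl, ht.1⟩, by simp [hh0, hR]⟩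
  have ha1 : a ∈ Icc (0:ℝ) 1 := ⟨ha0, hat.trans ht.2⟩
  have heq : ∀ s ∈ Icc (0:ℝ) 1, h a + ∫ r in a..s, F r = h s := by
    intro s hs
    rw [hsol.2 a ha1, hsol.2 s hs, add_assoc,
      intervalIntegral.integral_add_adjacent_intervals (hFi 0 h00 a ha1) (hFi a ha1 s hs)]
  set k := fun s => 2 * g s ^ 2 + 1 + ‖l' s‖ ^ 2 with hk
  have hg2 : IntegrableOn (fun s => 2 * g s ^ 2 + 1) (Icc 0 1) :=
    (hg_int.const_mul 2).add (integrable_const 1)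
  have hkint : IntegrableOn k (Icc 0 1) := hg2.add hl.2
  have hki : IntervalIntegrable k volume a t := by
    rw [intervalIntegrable_iff_integrableOn_Ioc_of_le hat]
    exact hkint.mono_set (Ioc_subset_Icc_self.trans (Icc_subset_Icc ha0 ht.2))
  have hkle : ∫ s in a..t, k s ≤ 2 * (∫ t in Icc (0:ℝ) 1, g t ^ 2) + 1 + α := by
    rw [intervalIntegral.integral_of_le hat]
    refine (setIntegral_mono_set hkint (ae_of_all _ fun s => by simp only [hk]; positivity)
      (Ioc_subset_Icc_self.trans (Icc_subset_Icc ha0 ht.2)).eventuallyLE).trans ?_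
    simp only [hk]
    rw [integral_add hg2 hl.2, integral_add (hg_int.const_mul 2) (integrable_const 1),
      integral_const_mul]
    simpa using hlα
  have key := increment_le hρ hat (hFi a ha1 t ht) (h a) hki (fun s hs => by
    have hs1 : s ∈ Icc (0:ℝ) 1 := ⟨ha0.trans hs.1.le, hs.2.trans ht.2⟩
    rw [heq s hs1]
    have hsK : K ≤ ‖h s‖ := by
      by_contra! hc
      exact absurd (hamax ⟨⟨hs1.1, hs.2⟩, hc.le.trans (le_max_left _ _)⟩) (not_le.2 hs.1)
    obtain ⟨hg1, hg2⟩ := max_le_iff.1 (hgrowth s hs1 (h s) hsK)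
    have hmx : max (‖h s‖ ^ 2) 0 = ‖h s‖ ^ 2 := max_eq_left (sq_nonneg _)
    have hp := hpos (‖h s‖ ^ 2)
    simp only [hρdef, hmx] at hp ⊢
    have hin : ⟪h s, F s⟫ ≤ ⟪h s, b s (h s)⟫ + ‖mVecT (σ s (h s)) (h s)‖ * ‖l' s‖ := by
      rw [hF, inner_add_right, inner_mVec]
      gcongr
      exact real_inner_le_norm _ _
    have hmul := mul_le_mul_of_nonneg_right hg2 (norm_nonneg (l' s))
    have hfr := frobSq_nonneg (σ s (h s))
    rw [one_div_mul_eq_div, div_le_iff₀ hp]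
    calc 2 * ⟪h s, F s⟫ ≤ g s * (1 + 2 * ‖l' s‖) * (γ (‖h s‖ ^ 2) + 1) := by nlinarith
      _ ≤ k s * (γ (‖h s‖ ^ 2) + 1) := by
        refine mul_le_mul_of_nonneg_right ?_ hp.le
        simp only [hk]
        nlinarith [sq_nonneg (g s - ‖l' s‖), sq_nonneg (g s - 1), sq_nonneg (g s)])
  rw [heq t ht] at key
  have hstart := hmono (pow_le_pow_left₀ (norm_nonneg (h a)) haR 2)
  have hend := hmono (show V ≤ ‖h t‖ ^ 2 by
    nlinarith [le_abs_self V, abs_nonneg V])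
  simp only at hstart hend
  linarith
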